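/- (Lemma 2.) Under the setting of Lemma 1 — a probability space (Ω, P), metric space (Z, dist), finite index set J with prototypes z_j, measurable J*: Ω → J, Z, Ẑ: Ω → Z, radii τ_j ≥ 0 such that dist(z, z_j) ≤ τ_j implies dist(z, z_j) < dist(z, z_i) for all i ≠ j, and a measurable minimum-distance decoder ĵ — set τ = min_{j ∈ J} τ_j. If moreover the end-to-end distortion is independent of the encoded concept, in the sense that P( dist(z_{J*}, Z) + dist(Z, Ẑ) > τ | J* = j ) = P( dist(z_{J*}, Z) + dist(Z, Ẑ) > τ ) for every j ∈ J with P(J* = j) > 0, then the probability of semantic error satisfies P(ĵ ≠ J*) ≤ P( dist(z_{J*}, Z) + dist(Z, Ẑ) > τ ). -/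

import Mathlib

open MeasureTheory ProbabilityTheory

/-- **Lemma 2.** Under the setting of Lemma 1, let `τ = min_j τ_j`. If the end-to-end
distortion is independent of the encoded concept, in the sense that conditioning on
`J* = j` does not change the probability that `dist (z J*) Z + dist Z Ẑ > τ` (for every
`j` of positive probability), then the probability of semantic error satisfies
`P(ĵ ≠ J*) ≤ P(dist (z J*) Z + dist Z Ẑ > τ)`. -/
theorem prob_semantic_error_le_no_priors
    {Ω : Type*} [MeasurableSpace Ω] (P : Measure Ω) [IsProbabilityMeasure P]
    {𝒵 : Type*} [MetricSpace 𝒵] [MeasurableSpace 𝒵] [BorelSpace 𝒵]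
    (J : ℕ) (z : Fin J → 𝒵)
    (Jstar : Ω → Fin J) (hJstar : Measurable Jstar)
    (Z Zhat : Ω → 𝒵) (hZ : Measurable Z) (hZhat : Measurable Zhat)
    (τj : Fin J → ℝ) (hτj : ∀ j, 0 ≤ τj j)
    (hball : ∀ j : Fin J, ∀ x : 𝒵, dist x (z j) ≤ τj j →
      ∀ i : Fin J, i ≠ j → dist x (z j) < dist x (z i))
    (jhat : Ω → Fin J) (hjhat : Measurable jhat)
    (hdec : ∀ ω : Ω, ∀ i : Fin J, dist (Zhat ω) (z (jhat ω)) ≤ dist (Zhat ω) (z i))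
    (τ : ℝ) (hτmin : IsLeast (Set.range τj) τ)
    (hindep : ∀ j : Fin J, P {ω | Jstar ω = j} ≠ 0 →
      (P[|{ω | Jstar ω = j}])
          {ω | τ < dist (z (Jstar ω)) (Z ω) + dist (Z ω) (Zhat ω)} =
        P {ω | τ < dist (z (Jstar ω)) (Z ω) + dist (Z ω) (Zhat ω)}) :
    P {ω | jhat ω ≠ Jstar ω} ≤
      P {ω | τ < dist (z (Jstar ω)) (Z ω) + dist (Z ω) (Zhat ω)} := by
  refine measure_mono fun ω hω => ?_
  by_contra hle
  rw [Set.mem_ofPred_eq, not_lt] at hle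
  have hdist : dist (Zhat ω) (z (Jstar ω)) ≤ τj (Jstar ω) := by
    calc dist (Zhat ω) (z (Jstar ω)) = dist (z (Jstar ω)) (Zhat ω) := dist_comm _ _
      _ ≤ dist (z (Jstar ω)) (Z ω) + dist (Z ω) (Zhat ω) := dist_triangle _ _ _
      _ ≤ τ := hle
      _ ≤ τj (Jstar ω) := hτmin.2 (Set.mem_range_self _)
  exact (hball (Jstar ω) (Zhat ω) hdist (jhat ω) hω).not_ge (hdec ω (Jstar ω))
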